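/- arXiv:2406.04219 — 2 statements merged into one kernel-verified Lean document; each statement's English description precedes it below -/
import Mathlib

section
/- (MALICE regret gap lower bound) There is a universal constant c > 0 such that for all integers u ≥ 2 and horizons H ≥ u, all β ∈ (0, 1/4], and all ε > 0 with ε·H ≤ 1/4, there exist a finite Markov Game with horizon H, complete deviation classes Φ, an expert policy σ_E satisfying u-recoverability and β-coverage, and a learner policy σ with MALICE loss ℓ_MALICE(σ) = max_{i∈[m]} max_{φ_i∈Φ_i} E_{s∼d^{π_{σ_E}}}[(d^{π_{σ,φ_i}}(s) / d^{π_{σ_E}}(s)) · ℓ_TV(σ_E(s), σ(s))] ≤ ε, such that the regret gap satisfies R_Φ(σ) − R_Φ(σ_E) ≥ c·ε·u·H. -/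
open scoped Classical

noncomputable section

namespace MAIL

/-- A finite Markov Game: horizon `H`, transition kernel `T`, per-agent rewards `r`,
and initial state distribution `ρ₀`.  The agents are indexed by `Fin m`, the state
space is `S`, and agent `i` has action space `A i`; a joint action is an element of
`∀ i, A i`. -/
structure MG (m : ℕ) (S : Type) (A : Fin m → Type) where
  H : ℕ
  T : S → (∀ i, A i) → S → ℝ
  r : Fin m → S → (∀ i, A i) → ℝ
  ρ₀ : S → ℝ

variable {m : ℕ} {S : Type} {A : Fin m → Type} [Fintype S] [∀ i, Fintype (A i)]

/-- The Markov game data is valid: `ρ₀` and each `T s a` are probability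
distributions, and all rewards take values in `[-1, 1]`. -/
def IsMG (G : MG m S A) : Prop :=
  (∀ s, 0 ≤ G.ρ₀ s) ∧ (∑ s, G.ρ₀ s) = 1 ∧
  (∀ s a, (∀ s', 0 ≤ G.T s a s') ∧ (∑ s', G.T s a s') = 1) ∧
  (∀ i s a, |G.r i s a| ≤ 1)

/-- A (mediator or joint) policy is a stochastic map from states to joint actions.
When all agents obediently follow the mediator policy `σ`, the induced joint policy
`π_σ` is `σ` itself. -/
def IsPolicy (π : S → (∀ i, A i) → ℝ) : Prop :=
  ∀ s, (∀ a, 0 ≤ π s a) ∧ (∑ a, π s a) = 1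

/-- Distribution over states at (0-indexed) step `h` under joint policy `π`. -/
def stateDist (G : MG m S A) (π : S → (∀ i, A i) → ℝ) : ℕ → S → ℝ
  | 0 => G.ρ₀
  | h + 1 => fun s' => ∑ s, ∑ a, stateDist G π h s * π s a * G.T s a s'

/-- Expected cumulative reward over horizon `G.H` of joint policy `π` when every
agent's reward function is `f`, i.e. `J(π, f)`. -/
def Jf (G : MG m S A) (π : S → (∀ i, A i) → ℝ) (f : S → (∀ i, A i) → ℝ) : ℝ :=
  ∑ h ∈ Finset.range G.H, ∑ s, ∑ a, stateDist G π h s * π s a * f s a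

/-- Value `J_i(π)` of joint policy `π` for agent `i` under the true rewards. -/
def J (G : MG m S A) (i : Fin m) (π : S → (∀ i, A i) → ℝ) : ℝ :=
  Jf G π (G.r i)

/-- Occupancy measure `ρ^π(s, a) = (1/H) ∑_h Pr_π(s_h = s, a_h = a)`. -/
def occ (G : MG m S A) (π : S → (∀ i, A i) → ℝ) (s : S) (a : ∀ i, A i) : ℝ :=
  (∑ h ∈ Finset.range G.H, stateDist G π h s * π s a) / G.H

/-- Average state visitation distribution `d^π(s) = ∑_a ρ^π(s, a)`. -/
def dAvg (G : MG m S A) (π : S → (∀ i, A i) → ℝ) (s : S) : ℝ :=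
  ∑ a, occ G π s a

/-- The joint policy `π_{σ, φ_i}` obtained from mediator policy `σ` when agent `i`
deviates via `φ : S → A i → A i` (playing `φ s a` when recommended `a` at state `s`)
while all other agents follow their recommendations. -/
def dev (σ : S → (∀ i, A i) → ℝ) (i : Fin m) (φ : S → A i → A i) :
    S → (∀ i, A i) → ℝ :=
  fun s b => ∑ a : ∀ j, A j, if Function.update a i (φ s (a i)) = b then σ s a else 0

/-- Regret `R_Φ(σ, f)` of mediator policy `σ` w.r.t. deviation classes `Φ`, when
`f` is used as every agent's reward function. -/
def regretF (G : MG m S A) (σ : S → (∀ i, A i) → ℝ)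
    (Φ : ∀ i : Fin m, Set (S → A i → A i)) (f : S → (∀ i, A i) → ℝ) : ℝ :=
  ⨆ i : Fin m, ⨆ φ : Φ i, (Jf G (dev σ i φ.1) f - Jf G σ f)

/-- Regret `R_Φ(σ)` of mediator policy `σ` under the true rewards. -/
def regret (G : MG m S A) (σ : S → (∀ i, A i) → ℝ)
    (Φ : ∀ i : Fin m, Set (S → A i → A i)) : ℝ :=
  ⨆ i : Fin m, ⨆ φ : Φ i, (J G i (dev σ i φ.1) - J G i σ)

/-- Value-to-go `V` of joint policy `π` with `k` steps remaining (so the value from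
step `h` in the paper corresponds to `k = H - h` remaining steps), with every
agent's reward given by `f`. -/
def Vgo (G : MG m S A) (f : S → (∀ i, A i) → ℝ) (π : S → (∀ i, A i) → ℝ) :
    ℕ → S → ℝ
  | 0 => fun _ => 0
  | k + 1 => fun s => ∑ a, π s a * (f s a + ∑ s', G.T s a s' * Vgo G f π k s')

/-- Q-value of joint policy `π` with `k` steps remaining. -/
def Qgo (G : MG m S A) (f : S → (∀ i, A i) → ℝ) (π : S → (∀ i, A i) → ℝ)
    (k : ℕ) (s : S) (a : ∀ i, A i) : ℝ :=
  match k with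
  | 0 => 0
  | k + 1 => f s a + ∑ s', G.T s a s' * Vgo G f π k s'

/-- Advantage `A = Q - V` of joint policy `π` with `k` steps remaining. -/
def Adv (G : MG m S A) (f : S → (∀ i, A i) → ℝ) (π : S → (∀ i, A i) → ℝ)
    (k : ℕ) (s : S) (a : ∀ i, A i) : ℝ :=
  Qgo G f π k s a - Vgo G f π k s

/-- `u`-recoverability: the advantage of any expert-plus-single-deviation joint
policy `π_{σ_E, φ_i}` is bounded by `u` at every state, joint action, and step. -/
def Recoverable (G : MG m S A) (Φ : ∀ i : Fin m, Set (S → A i → A i))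
    (σE : S → (∀ i, A i) → ℝ) (u : ℝ) : Prop :=
  ∀ i : Fin m, ∀ φ ∈ Φ i, ∀ k ≤ G.H, ∀ s a, |Adv G (G.r i) (dev σE i φ) k s a| ≤ u

/-- `β`-coverage: the expert's average state distribution puts mass at least `β`
on every state. -/
def Coverage (G : MG m S A) (σE : S → (∀ i, A i) → ℝ) (β : ℝ) : Prop :=
  ∀ s, β ≤ dAvg G σE s

/-- Total variation distance between two finitely supported distributions. -/
def tv {α : Type} [Fintype α] (p q : α → ℝ) : ℝ :=
  (∑ a, |p a - q a|) / 2

/-- Sums over the joint actions of a single agent with two actions. -/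
lemma sum_joint_two {M : Type*} [AddCommMonoid M] (F : (∀ _ : Fin 1, Fin 2) → M) :
    ∑ a, F a = F (fun _ => 0) + F (fun _ => 1) := by
  rw [← (Equiv.funUnique (Fin 1) (Fin 2)).symm.sum_comp F, Fin.sum_univ_two]
  rfl

/-- The probability of moving to the good state `0` in the switching game. -/
def goodProb (p : ℝ) (s : Fin 2) (a : ∀ _ : Fin 1, Fin 2) : ℝ :=
  if s = 0 ∧ a 0 = 0 then 1 - p else p

/-- A single-agent game on a good state `0` (reward `1`) and a bad state `1` (reward `0`).
The state switches with probability `p`, except that action `1` in the good state leads to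
the bad state with probability `1 - p`. -/
def switchGame (H : ℕ) (p : ℝ) : MG 1 (Fin 2) (fun _ => Fin 2) where
  H := H
  T s a s' := if s' = 0 then goodProb p s a else 1 - goodProb p s a
  r _ s _ := if s = 0 then 1 else 0
  ρ₀ _ := 1 / 2

/-- The policy playing action `1` with probability `q s` in state `s`. -/
def mixPolicy (q : Fin 2 → ℝ) (s : Fin 2) (a : ∀ _ : Fin 1, Fin 2) : ℝ :=
  if a 0 = 0 then 1 - q s else q s

/-- The probability of playing action `1` after deviating from `mixPolicy q` via `φ`. -/
def devProb (q : Fin 2 → ℝ) (φ : Fin 2 → Fin 2 → Fin 2) (s : Fin 2) : ℝ :=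
  (if φ s 0 = 1 then 1 - q s else 0) + (if φ s 1 = 1 then q s else 0)

lemma devProb_nonneg {q : Fin 2 → ℝ} (hq : ∀ s, 0 ≤ q s ∧ q s ≤ 1)
    (φ : Fin 2 → Fin 2 → Fin 2) (s : Fin 2) : 0 ≤ devProb q φ s := by
  have := hq s
  unfold devProb
  split_ifs <;> linarith

lemma devProb_le_one {q : Fin 2 → ℝ} (hq : ∀ s, 0 ≤ q s ∧ q s ≤ 1)
    (φ : Fin 2 → Fin 2 → Fin 2) (s : Fin 2) : devProb q φ s ≤ 1 := by
  have := hq s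
  unfold devProb
  split_ifs <;> linarith

lemma dev_mixPolicy (q : Fin 2 → ℝ) (i : Fin 1) (φ : Fin 2 → Fin 2 → Fin 2) :
    dev (m := 1) (A := fun _ => Fin 2) (mixPolicy q) i φ = mixPolicy (devProb q φ) := by
  obtain rfl : i = 0 := Subsingleton.elim _ _
  funext s b
  have hupd : ∀ a : (∀ _ : Fin 1, Fin 2),
      Function.update a 0 (φ s (a 0)) = b ↔ φ s (a 0) = b 0 := by
    intro a
    constructor
    · intro h
      simpa using congrFun h 0
    · intro h
      funext j
      obtain rfl : j = 0 := Subsingleton.elim _ _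
      simpa using h
  have hdev : dev (m := 1) (A := fun _ => Fin 2) (mixPolicy q) 0 φ s b =
      ∑ a : (∀ _ : Fin 1, Fin 2), if φ s (a 0) = b 0 then mixPolicy q s a else 0 :=
    Finset.sum_congr rfl fun a _ => by simp only [hupd a]
  rw [hdev, sum_joint_two]
  simp only [mixPolicy, devProb]
  generalize b 0 = b0
  generalize φ s 0 = f0
  generalize φ s 1 = f1
  fin_cases b0 <;> fin_cases f0 <;> fin_cases f1 <;> simp

/-- The probability of being in the good state at step `h` of the switching game when action
`1` is played there with probability `q`. -/
def goodMass (p q : ℝ) : ℕ → ℝ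
  | 0 => 1 / 2
  | h + 1 => p + (1 - 2 * p) * (1 - q) * goodMass p q h

lemma stateDist_switchGame (H : ℕ) (p : ℝ) (q : Fin 2 → ℝ) (h : ℕ) :
    stateDist (switchGame H p) (mixPolicy q) h =
      fun s => if s = 0 then goodMass p (q 0) h else 1 - goodMass p (q 0) h := by
  induction h with
  | zero => funext s; simp [stateDist, switchGame, goodMass]; norm_num
  | succ h ih =>
    funext s
    simp only [stateDist, ih, goodMass, Fin.sum_univ_two, sum_joint_two]
    simp only [mixPolicy, switchGame, goodProb]
    fin_cases s <;> simp <;> ring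

lemma J_switchGame (H : ℕ) (p : ℝ) (q : Fin 2 → ℝ) (i : Fin 1) :
    J (switchGame H p) i (mixPolicy q) = ∑ h ∈ Finset.range H, goodMass p (q 0) h := by
  unfold J Jf
  refine Finset.sum_congr rfl fun h _ => ?_
  simp only [stateDist_switchGame, Fin.sum_univ_two, sum_joint_two]
  simp [mixPolicy, switchGame]
  ring

lemma dAvg_switchGame (H : ℕ) (p : ℝ) (q : Fin 2 → ℝ) (s : Fin 2) :
    dAvg (switchGame H p) (mixPolicy q) s =
      (∑ h ∈ Finset.range H,
        if s = 0 then goodMass p (q 0) h else 1 - goodMass p (q 0) h) / H := by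
  unfold dAvg occ
  rw [sum_joint_two, ← add_div, ← Finset.sum_add_distrib]
  simp only [stateDist_switchGame]
  congr 1
  refine Finset.sum_congr rfl fun h _ => ?_
  simp only [mixPolicy, if_true, one_ne_zero, if_false]
  ring

lemma sum_dAvg_switchGame {H : ℕ} (hH : 0 < H) (p : ℝ) (q : Fin 2 → ℝ) :
    dAvg (switchGame H p) (mixPolicy q) 0 + dAvg (switchGame H p) (mixPolicy q) 1 = 1 := by
  have hH' : (H : ℝ) ≠ 0 := by positivity
  simp only [dAvg_switchGame, ← add_div, ← Finset.sum_add_distrib]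
  simp [hH']

lemma goodMass_zero_right (p : ℝ) (h : ℕ) : goodMass p 0 h = 1 / 2 := by
  induction h with
  | zero => rfl
  | succ h ih => rw [goodMass, ih]; ring

lemma goodMass_mem {p q : ℝ} (hp0 : 0 ≤ p) (hp1 : p ≤ 1 / 2) (hq0 : 0 ≤ q) (hq1 : q ≤ 1)
    (h : ℕ) : 0 ≤ goodMass p q h ∧ goodMass p q h ≤ 1 / 2 := by
  induction h with
  | zero => norm_num [goodMass]
  | succ h ih =>
    obtain ⟨h0, h1⟩ := ih
    have hl : 0 ≤ 1 - 2 * p := by linarith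
    have hm : (1 - q) * goodMass p q h ≤ 1 / 2 := by nlinarith
    have hn : 0 ≤ (1 - q) * goodMass p q h := mul_nonneg (by linarith) h0
    rw [goodMass, mul_assoc]
    constructor <;> nlinarith

/-- Playing action `1` with probability `ε` moves mass away from the good state at a rate
proportional to `ε`, until about `1 / (2 * p)` steps have passed. -/
lemma goodMass_le {u p ε : ℝ} (hu : 2 ≤ u) (hpu : 2 * p * u = 1) (hε : 0 ≤ ε)
    (hεu : ε * u ≤ 1 / 4) (h : ℕ) :
    goodMass p ε h ≤ 1 / 2 - ε / 9 * min (h : ℝ) u := by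
  have hu0 : 0 < u := by linarith
  induction h with
  | zero => simp [goodMass, hu0.le]
  | succ h ih =>
    have hM : min ((h + 1 : ℕ) : ℝ) u ≤ min (h : ℝ) u + 1 := by
      push_cast
      rcases le_total (h : ℝ) u with hc | hc
      · rw [min_eq_left hc]; exact min_le_left _ _
      · rw [min_eq_right hc]; exact (min_le_right _ _).trans (by linarith)
    have hMu : min (h : ℝ) u ≤ u := min_le_right _ _
    have hM0 : 0 ≤ min (h : ℝ) u := le_min (by positivity) hu0.le
    generalize min (h : ℝ) u = M at ih hM hMu hM0
    have hp0 : 0 < p := by nlinarith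
    have hp1 : p ≤ 1 / 4 := by nlinarith
    have hε1 : ε ≤ 1 / 8 := by nlinarith
    have hpM : p * M ≤ 1 / 2 := by nlinarith
    have hεM : ε * M ≤ 1 / 4 := by nlinarith
    have hμ : 0 ≤ (1 - 2 * p) * (1 - ε) := mul_nonneg (by linarith) (by linarith)
    have h1 := mul_le_mul_of_nonneg_left ih hμ
    have h2 : ε / 9 * min ((h + 1 : ℕ) : ℝ) u ≤ ε / 9 * (M + 1) :=
      mul_le_mul_of_nonneg_left hM (by positivity)
    have h3 : ε * p ≤ ε * (1 / 4) := mul_le_mul_of_nonneg_left hp1 hε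
    have h4 : ε * (p * M) ≤ ε * (1 / 2) := mul_le_mul_of_nonneg_left hpM hε
    have h5 : ε * (ε * M) ≤ ε * (1 / 4) := mul_le_mul_of_nonneg_left hεM hε
    have h6 : 0 ≤ ε * p * (ε * M) := by positivity
    rw [goodMass]
    nlinarith

lemma mul_le_mul_min {u H h : ℝ} (hh : 0 ≤ h) (hu : 0 ≤ u) (hhH : h ≤ H) (huH : u ≤ H) :
    u * h ≤ H * min h u := by
  rcases le_total h u with hc | hc
  · rw [min_eq_left hc]; nlinarith
  · rw [min_eq_right hc]; nlinarith

lemma sum_goodMass_le {u H : ℕ} (hu : 2 ≤ u) (huH : u ≤ H) {p ε : ℝ}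
    (hpu : 2 * p * u = 1) (hε : 0 ≤ ε)
    (hεH : ε * H ≤ 1 / 4) :
    ∑ h ∈ Finset.range H, goodMass p ε h ≤ H / 2 - 1 / 36 * ε * u * H := by
  have hu' : (2 : ℝ) ≤ u := by exact_mod_cast hu
  have huH' : (u : ℝ) ≤ H := by exact_mod_cast huH
  have hH : (0 : ℝ) < H := by linarith
  have hεu : ε * u ≤ 1 / 4 := (mul_le_mul_of_nonneg_left huH' hε).trans hεH
  have hterm : ∀ h ∈ Finset.range H,
      goodMass p ε h ≤ 1 / 2 - ε * u / (9 * H) * (h : ℝ) := by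
    intro h hh
    have hhH : (h : ℝ) ≤ H := by exact_mod_cast (Finset.mem_range.mp hh).le
    have hmin : u * h / H ≤ min (h : ℝ) u := by
      rw [div_le_iff₀ hH, mul_comm (min _ _)]
      exact mul_le_mul_min (by positivity) (by positivity) hhH huH'
    have heq : ε * u / (9 * H) * (h : ℝ) = ε / 9 * (u * h / H) := by field_simp
    rw [heq]
    exact (goodMass_le hu' hpu hε hεu h).trans
      (sub_le_sub_left (mul_le_mul_of_nonneg_left hmin (by positivity)) _)
  refine (Finset.sum_le_sum hterm).trans ?_
  have hgauss : ∑ h ∈ Finset.range H, (h : ℝ) = H * (H - 1) / 2 := by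
    clear hterm huH huH' hεH hH
    induction H with
    | zero => simp
    | succ n ih => rw [Finset.sum_range_succ, ih]; push_cast; ring
  rw [Finset.sum_sub_distrib, ← Finset.mul_sum, hgauss]
  simp only [Finset.sum_const, Finset.card_range, nsmul_eq_mul]
  have heq : ε * u / (9 * H) * ((H : ℝ) * (H - 1) / 2) = ε * u * (H - 1) / 18 := by
    field_simp
    ring
  rw [heq]
  have : 0 ≤ ε * u * (H - 2) := mul_nonneg (by positivity) (by linarith)
  linarith

lemma isMG_switchGame (H : ℕ) {p : ℝ} (hp0 : 0 ≤ p) (hp1 : p ≤ 1) :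
    IsMG (switchGame H p) := by
  have hg : ∀ s a, 0 ≤ goodProb p s a ∧ goodProb p s a ≤ 1 := by
    intro s a
    unfold goodProb
    split_ifs <;> constructor <;> linarith
  refine ⟨fun _ => by norm_num [switchGame], by norm_num [switchGame, Fin.sum_univ_two],
    fun s a => ⟨fun s' => ?_, by simp [switchGame, Fin.sum_univ_two]⟩, fun i s a => ?_⟩
  · have := hg s a
    simp only [switchGame]
    split_ifs <;> linarith
  · simp only [switchGame]
    split_ifs <;> norm_num

lemma isPolicy_mixPolicy {q : Fin 2 → ℝ} (hq : ∀ s, 0 ≤ q s ∧ q s ≤ 1) :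
    IsPolicy (m := 1) (A := fun _ => Fin 2) (mixPolicy q) := by
  intro s
  refine ⟨fun a => ?_, by rw [sum_joint_two]; simp [mixPolicy]⟩
  have := hq s
  unfold mixPolicy
  split_ifs <;> linarith

lemma Vgo_switchGame_succ_sub (H : ℕ) (p : ℝ) (q : Fin 2 → ℝ) (i : Fin 1) (k : ℕ) :
    Vgo (switchGame H p) ((switchGame H p).r i) (mixPolicy q) (k + 1) 0 -
      Vgo (switchGame H p) ((switchGame H p).r i) (mixPolicy q) (k + 1) 1 =
    1 + (1 - 2 * p) * (1 - q 0) *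
      (Vgo (switchGame H p) ((switchGame H p).r i) (mixPolicy q) k 0 -
        Vgo (switchGame H p) ((switchGame H p).r i) (mixPolicy q) k 1) := by
  simp only [Vgo, Fin.sum_univ_two, sum_joint_two]
  simp [mixPolicy, switchGame, goodProb]
  ring

lemma Vgo_switchGame_sub_mem (H : ℕ) {u p : ℝ} (hu : 0 ≤ u) (hp1 : p ≤ 1 / 2)
    (hpu : 1 ≤ 2 * p * u) {q : Fin 2 → ℝ} (hq : ∀ s, 0 ≤ q s ∧ q s ≤ 1) (i : Fin 1) (k : ℕ) :
    0 ≤ Vgo (switchGame H p) ((switchGame H p).r i) (mixPolicy q) k 0 -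
        Vgo (switchGame H p) ((switchGame H p).r i) (mixPolicy q) k 1 ∧
      Vgo (switchGame H p) ((switchGame H p).r i) (mixPolicy q) k 0 -
        Vgo (switchGame H p) ((switchGame H p).r i) (mixPolicy q) k 1 ≤ u := by
  induction k with
  | zero => simpa [Vgo] using hu
  | succ k ih =>
    rw [Vgo_switchGame_succ_sub]
    generalize Vgo (switchGame H p) ((switchGame H p).r i) (mixPolicy q) k 0 -
      Vgo (switchGame H p) ((switchGame H p).r i) (mixPolicy q) k 1 = D at ih ⊢
    obtain ⟨h0, h1⟩ := ih
    have hl : 0 ≤ 1 - 2 * p := by linarith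
    have hqD : (1 - q 0) * D ≤ u := by nlinarith [(hq 0).1]
    have hqD0 : 0 ≤ (1 - q 0) * D := mul_nonneg (by linarith [(hq 0).2]) h0
    rw [mul_assoc]
    constructor
    · have := mul_nonneg hl hqD0
      linarith
    · have := mul_le_mul_of_nonneg_left hqD hl
      linarith

lemma abs_Adv_switchGame_le (H : ℕ) {u p : ℝ} (hu : 0 ≤ u) (hp0 : 0 ≤ p) (hp1 : p ≤ 1 / 2)
    (hpu : 1 ≤ 2 * p * u) {q : Fin 2 → ℝ} (hq : ∀ s, 0 ≤ q s ∧ q s ≤ 1)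
    (i : Fin 1) (k : ℕ) (s : Fin 2) (a : ∀ _ : Fin 1, Fin 2) :
    |Adv (switchGame H p) ((switchGame H p).r i) (mixPolicy q) k s a| ≤ u := by
  cases k with
  | zero => simpa [Adv, Qgo, Vgo] using hu
  | succ k =>
    obtain ⟨h0, h1⟩ := Vgo_switchGame_sub_mem H hu hp1 hpu hq i k
    have hform : Adv (switchGame H p) ((switchGame H p).r i) (mixPolicy q) (k + 1) s a =
        (goodProb p s a -
          ((1 - q s) * goodProb p s (fun _ => 0) + q s * goodProb p s (fun _ => 1))) *
        (Vgo (switchGame H p) ((switchGame H p).r i) (mixPolicy q) k 0 -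
          Vgo (switchGame H p) ((switchGame H p).r i) (mixPolicy q) k 1) := by
      simp only [Adv, Qgo, Vgo, Fin.sum_univ_two, sum_joint_two]
      simp [mixPolicy, switchGame]
      ring
    rw [hform, abs_mul, abs_of_nonneg h0]
    have hg : ∀ b, 0 ≤ goodProb p s b ∧ goodProb p s b ≤ 1 := by
      intro b
      unfold goodProb
      split_ifs <;> constructor <;> linarith
    have hc : |goodProb p s a -
        ((1 - q s) * goodProb p s (fun _ => 0) + q s * goodProb p s (fun _ => 1))| ≤ 1 := by
      obtain ⟨q0, q1⟩ := hq s
      obtain ⟨a0, a1⟩ := hg a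
      obtain ⟨b0, b1⟩ := hg fun _ => 0
      obtain ⟨c0, c1⟩ := hg fun _ => 1
      rw [abs_le]
      constructor <;> nlinarith
    calc _ ≤ 1 * (Vgo (switchGame H p) ((switchGame H p).r i) (mixPolicy q) k 0 -
          Vgo (switchGame H p) ((switchGame H p).r i) (mixPolicy q) k 1) :=
        mul_le_mul_of_nonneg_right hc h0
      _ ≤ u := by linarith

lemma tv_mixPolicy (q q' : Fin 2 → ℝ) (s : Fin 2) :
    tv (mixPolicy q s) (mixPolicy q' s) = |q s - q' s| := by
  unfold tv
  rw [sum_joint_two]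
  simp [mixPolicy, abs_sub_comm (q' s)]

lemma regret_switchGame_expert_le (H : ℕ) {p : ℝ} (hp0 : 0 ≤ p) (hp1 : p ≤ 1 / 2) :
    regret (switchGame H p) (mixPolicy 0) (fun _ => Set.univ) ≤ 0 := by
  refine Real.iSup_le (fun i => Real.iSup_le (fun φ => ?_) le_rfl) le_rfl
  have hq : ∀ s, 0 ≤ (0 : Fin 2 → ℝ) s ∧ (0 : Fin 2 → ℝ) s ≤ 1 := fun s => by simp
  rw [dev_mixPolicy, J_switchGame, J_switchGame, sub_nonpos]
  refine Finset.sum_le_sum fun h _ => ?_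
  rw [Pi.zero_apply, goodMass_zero_right]
  exact (goodMass_mem hp0 hp1 (devProb_nonneg hq _ 0) (devProb_le_one hq _ 0) h).2

/-- Deviating to the constant action `0` recovers the value of the expert. -/
lemma le_regret_switchGame (H : ℕ) (p ε : ℝ) :
    H / 2 - ∑ h ∈ Finset.range H, goodMass p ε h ≤
      regret (switchGame H p) (mixPolicy fun _ => ε) (fun _ => Set.univ) := by
  have hdev : devProb (fun _ => ε) (fun _ _ => 0) 0 = 0 := by simp [devProb]
  have hval : J (switchGame H p) 0
        (dev (m := 1) (A := fun _ => Fin 2) (mixPolicy fun _ => ε) 0 fun _ _ => 0) -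
      J (switchGame H p) 0 (mixPolicy fun _ => ε) =
      H / 2 - ∑ h ∈ Finset.range H, goodMass p ε h := by
    rw [dev_mixPolicy, J_switchGame, J_switchGame, hdev]
    simp only [goodMass_zero_right, Finset.sum_const, Finset.card_range, nsmul_eq_mul]
    ring
  rw [← hval]
  unfold regret
  refine le_ciSup_of_le (Set.finite_range _).bddAbove 0 ?_
  exact le_ciSup_of_le (Set.finite_range _).bddAbove ⟨fun _ _ => 0, Set.mem_univ _⟩ le_rfl

/-- **MALICE regret gap lower bound.** There is a universal constant
`c > 0` such that for all integers `u ≥ 2`, horizons `H ≥ u`, all `β ∈ (0, 1/4]`,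
and all `ε > 0` with `ε·H ≤ 1/4`, there exist a finite Markov Game with horizon
`H`, complete deviation classes, an expert satisfying `u`-recoverability and
`β`-coverage, and a learner with MALICE loss at most `ε`, whose regret gap is at
least `c·ε·u·H`. -/
theorem malice_regret_gap_lower_bound :
    ∃ c : ℝ, 0 < c ∧
      ∀ (u H : ℕ), 2 ≤ u → u ≤ H →
      ∀ β : ℝ, 0 < β → β ≤ 1 / 4 →
      ∀ ε : ℝ, 0 < ε → ε * H ≤ 1 / 4 →
      ∃ (m : ℕ) (_ : 0 < m) (nS : ℕ) (nA : Fin m → ℕ)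
        (G : MG m (Fin nS) (fun i => Fin (nA i)))
        (Φ : ∀ i : Fin m, Set (Fin nS → Fin (nA i) → Fin (nA i)))
        (σE σ : Fin nS → (∀ i, Fin (nA i)) → ℝ),
        IsMG G ∧ G.H = H ∧ (∀ i, Φ i = Set.univ) ∧
        IsPolicy σE ∧ IsPolicy σ ∧
        Recoverable G Φ σE (u : ℝ) ∧ Coverage G σE β ∧
        (∀ i : Fin m, ∀ φ ∈ Φ i,
          (∑ s, dAvg G σE s * (dAvg G (dev σ i φ) s / dAvg G σE s * tv (σE s) (σ s))) ≤ ε) ∧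
        c * ε * u * H ≤ regret G σ Φ - regret G σE Φ := by
  refine ⟨1 / 36, by norm_num, fun u H hu huH β _ hβ ε hε hεH => ?_⟩
  have hu' : (2 : ℝ) ≤ u := by exact_mod_cast hu
  have huH' : (u : ℝ) ≤ H := by exact_mod_cast huH
  have hH : 0 < H := by omega
  have hHpos : (0 : ℝ) < H := by exact_mod_cast hH
  have hε1 : ε ≤ 1 := by nlinarith
  have hp0 : (0 : ℝ) ≤ 1 / (2 * u) := by positivity
  have hp1 : (1 : ℝ) / (2 * u) ≤ 1 / 2 := by
    rw [div_le_div_iff₀ (by positivity) (by norm_num)]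
    linarith
  have hpu : 2 * (1 / (2 * (u : ℝ))) * u = 1 := by field_simp
  have hqE : ∀ s, 0 ≤ (0 : Fin 2 → ℝ) s ∧ (0 : Fin 2 → ℝ) s ≤ 1 := fun s => by simp
  have hcov : ∀ s, dAvg (switchGame H (1 / (2 * u))) (mixPolicy 0) s = 1 / 2 := by
    intro s
    rw [dAvg_switchGame]
    simp only [Pi.zero_apply, goodMass_zero_right]
    norm_num
    field_simp
  refine ⟨1, one_pos, 2, fun _ => 2, switchGame H (1 / (2 * u)), fun _ => Set.univ,
    mixPolicy 0, mixPolicy fun _ => ε, isMG_switchGame H hp0 (by linarith), rfl,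
    fun _ => rfl, isPolicy_mixPolicy hqE, isPolicy_mixPolicy fun _ => ⟨hε.le, hε1⟩,
    ?_, ?_, ?_, ?_⟩
  · intro i φ _ k _ s a
    rw [dev_mixPolicy]
    exact abs_Adv_switchGame_le H (by linarith) hp0 hp1 hpu.ge
      (fun s => ⟨devProb_nonneg hqE φ s, devProb_le_one hqE φ s⟩) i k s a
  · intro s
    rw [hcov]
    linarith
  · intro i φ _
    have hsum := sum_dAvg_switchGame hH (1 / (2 * (u : ℝ))) (devProb (fun _ => ε) φ)
    rw [dev_mixPolicy, Fin.sum_univ_two]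
    simp only [hcov, tv_mixPolicy, Pi.zero_apply, zero_sub, abs_neg, abs_of_pos hε]
    refine le_of_eq ?_
    linear_combination ε * hsum
  · have h1 := regret_switchGame_expert_le H hp0 hp1
    have h2 := le_regret_switchGame H (1 / (2 * (u : ℝ))) ε
    have h3 := sum_goodMass_le hu huH hpu hε.le hεH
    linarith

end MAIL
end
end

section
/- (BLADES regret gap upper bound) There is a universal constant C such that in any finite Markov Game with deviation classes Φ, if the game is u-recoverable with respect to the expert σ_E, and the learner σ satisfies the BLADES loss guarantee ℓ_BLADES(σ) = max_{i∈[m]} max_{φ_i∈Φ_i} E_{s∼d^{π_{σ,φ_i}}}[ℓ_TV(σ_E(s), σ(s))] ≤ ε, then the regret gap satisfies R_Φ(σ) − R_Φ(σ_E) ≤ C·ε·u·H. -/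
open scoped Classical

noncomputable section

namespace MAIL

variable {m : ℕ} {S : Type} {A : Fin m → Type} [Fintype S] [∀ i, Fintype (A i)]

/-- One step of one policy, evaluated against the value functions of another policy. -/
theorem sum_stateDist_mul_Adv (G : MG m S A) (f : S → (∀ i, A i) → ℝ)
    (π π' : S → (∀ i, A i) → ℝ) (hπ : ∀ s, ∑ a, π s a = 1) (k h : ℕ) :
    ∑ s, ∑ a, stateDist G π h s * π s a * f s a
        + ∑ s, stateDist G π (h + 1) s * Vgo G f π' k s
      = ∑ s, stateDist G π h s * Vgo G f π' (k + 1) s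
        + ∑ s, ∑ a, stateDist G π h s * π s a * Adv G f π' (k + 1) s a := by
  have hnext : ∑ s', stateDist G π (h + 1) s' * Vgo G f π' k s'
      = ∑ s, ∑ a, stateDist G π h s * π s a * ∑ s', G.T s a s' * Vgo G f π' k s' := by
    simp only [stateDist, Finset.sum_mul, Finset.mul_sum]
    rw [Finset.sum_comm]
    refine Finset.sum_congr rfl fun s _ => ?_
    rw [Finset.sum_comm]
    refine Finset.sum_congr rfl fun a _ => Finset.sum_congr rfl fun s' _ => by ring
  rw [hnext, ← Finset.sum_add_distrib, ← Finset.sum_add_distrib]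
  refine Finset.sum_congr rfl fun s _ => ?_
  have hV : stateDist G π h s * Vgo G f π' (k + 1) s
      = ∑ a, stateDist G π h s * π s a * Vgo G f π' (k + 1) s := by
    rw [← Finset.sum_mul, ← Finset.mul_sum, hπ s, mul_one]
  rw [hV, ← Finset.sum_add_distrib, ← Finset.sum_add_distrib]
  refine Finset.sum_congr rfl fun a _ => ?_
  simp only [Adv, Qgo]
  ring

/-- The reward collected by `π` over `k` steps from step `h`, decomposed into the value and the
advantages of a reference policy. -/
theorem sum_reward_eq_Vgo_add_Adv (G : MG m S A) (f : S → (∀ i, A i) → ℝ)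
    (π π' : S → (∀ i, A i) → ℝ) (hπ : ∀ s, ∑ a, π s a = 1) (k h : ℕ) :
    ∑ j ∈ Finset.range k, ∑ s, ∑ a, stateDist G π (h + j) s * π s a * f s a
      = ∑ s, stateDist G π h s * Vgo G f π' k s
        + ∑ j ∈ Finset.range k, ∑ s, ∑ a,
            stateDist G π (h + j) s * π s a * Adv G f π' (k - j) s a := by
  induction k generalizing h with
  | zero => simp [Vgo]
  | succ k ih =>
    have hstep := sum_stateDist_mul_Adv G f π π' hπ k h
    have hrec := ih (h + 1)
    rw [Finset.sum_range_succ', Finset.sum_range_succ']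
    simp only [Nat.add_sub_add_right, Nat.sub_zero, Nat.add_zero]
    simp only [Nat.add_right_comm h 1] at hrec
    simp only [← Nat.add_assoc]
    linarith

theorem sum_mul_Adv_self (G : MG m S A) (f : S → (∀ i, A i) → ℝ)
    (π : S → (∀ i, A i) → ℝ) (hπ : ∀ s, ∑ a, π s a = 1) (k : ℕ) (s : S) :
    ∑ a, π s a * Adv G f π k s a = 0 := by
  cases k with
  | zero => simp [Adv, Qgo, Vgo]
  | succ k =>
    simp only [Adv, Qgo, mul_sub, Finset.sum_sub_distrib, ← Finset.sum_mul, hπ s, one_mul]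
    simp [Vgo]

/-- Performance difference lemma. -/
theorem Jf_sub_Jf (G : MG m S A) (f : S → (∀ i, A i) → ℝ)
    (π π' : S → (∀ i, A i) → ℝ) (hπ : ∀ s, ∑ a, π s a = 1) (hπ' : ∀ s, ∑ a, π' s a = 1) :
    Jf G π f - Jf G π' f
      = ∑ h ∈ Finset.range G.H, ∑ s,
          stateDist G π h s * ∑ a, (π s a - π' s a) * Adv G f π' (G.H - h) s a := by
  have hval := sum_reward_eq_Vgo_add_Adv G f π π' hπ G.H 0
  have hval' := sum_reward_eq_Vgo_add_Adv G f π' π' hπ' G.H 0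
  simp only [Nat.zero_add, mul_assoc, ← Finset.mul_sum, sum_mul_Adv_self G f π' hπ', mul_zero,
    Finset.sum_const_zero, add_zero] at hval hval'
  simp only [Jf, mul_assoc, ← Finset.mul_sum, hval, hval', sub_mul, Finset.sum_sub_distrib,
    sum_mul_Adv_self G f π' hπ', sub_zero]
  simp only [stateDist]
  ring

theorem stateDist_nonneg (G : MG m S A) (hG : IsMG G) (π : S → (∀ i, A i) → ℝ)
    (hπ : IsPolicy π) (h : ℕ) (s : S) : 0 ≤ stateDist G π h s := by
  induction h generalizing s with
  | zero => exact hG.1 s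
  | succ h ih =>
    exact Finset.sum_nonneg fun s' _ => Finset.sum_nonneg fun a _ =>
      mul_nonneg (mul_nonneg (ih s') ((hπ s').1 a)) ((hG.2.2.1 s' a).1 s)

theorem IsPolicy.dev {σ : S → (∀ i, A i) → ℝ} (hσ : IsPolicy σ) (i : Fin m)
    (φ : S → A i → A i) : IsPolicy (dev σ i φ) := by
  refine fun s => ⟨fun b => Finset.sum_nonneg fun a _ => ?_, ?_⟩
  · split_ifs
    exacts [(hσ s).1 a, le_rfl]
  · simp only [MAIL.dev]
    rw [Finset.sum_comm]
    simpa using (hσ s).2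

theorem dev_id (σ : S → (∀ i, A i) → ℝ) (i : Fin m) : dev σ i (fun _ a => a) = σ := by
  funext s b
  simp [dev]

/-- Applying a deviation does not increase the `ℓ¹` distance between recommendations. -/
theorem sum_abs_dev_sub_dev_le (σ σ' : S → (∀ i, A i) → ℝ) (i : Fin m) (φ : S → A i → A i)
    (s : S) : ∑ b, |dev σ i φ s b - dev σ' i φ s b| ≤ ∑ a, |σ s a - σ' s a| := by
  calc ∑ b, |dev σ i φ s b - dev σ' i φ s b|
      ≤ ∑ b, ∑ a : ∀ j, A j,
          if Function.update a i (φ s (a i)) = b then |σ s a - σ' s a| else 0 := by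
        refine Finset.sum_le_sum fun b _ => ?_
        simp only [dev, ← Finset.sum_sub_distrib]
        refine (Finset.abs_sum_le_sum_abs _ _).trans (Finset.sum_le_sum fun a _ => ?_)
        split_ifs <;> simp
    _ = ∑ a, |σ s a - σ' s a| := by
        rw [Finset.sum_comm]
        simp

theorem dAvg_eq (G : MG m S A) (π : S → (∀ i, A i) → ℝ) (hπ : ∀ s, ∑ a, π s a = 1) (s : S) :
    dAvg G π s = (∑ h ∈ Finset.range G.H, stateDist G π h s) / G.H := by
  simp only [dAvg, occ]
  rw [← Finset.sum_div, Finset.sum_comm]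
  simp [← Finset.mul_sum, hπ s]

/-- Two policies under the same deviation have close values if the second has bounded advantages
and the recommendations are close on the states visited by the first. -/
theorem abs_J_dev_sub_J_dev_le (G : MG m S A) (hG : IsMG G) {σE σ : S → (∀ i, A i) → ℝ}
    (hσE : IsPolicy σE) (hσ : IsPolicy σ) (i : Fin m) (φ : S → A i → A i) {u ε : ℝ}
    (hu0 : 0 ≤ u) (hu : ∀ k ≤ G.H, ∀ s a, |Adv G (G.r i) (dev σE i φ) k s a| ≤ u)
    (hε : ∑ s, dAvg G (dev σ i φ) s * tv (σE s) (σ s) ≤ ε) :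
    |J G i (dev σ i φ) - J G i (dev σE i φ)| ≤ 2 * ε * u * G.H := by
  have hD := stateDist_nonneg G hG _ (hσ.dev i φ)
  have hlocal : ∀ h s, |∑ a, (dev σ i φ s a - dev σE i φ s a)
      * Adv G (G.r i) (dev σE i φ) (G.H - h) s a| ≤ 2 * u * tv (σE s) (σ s) := by
    intro h s
    calc _ ≤ ∑ a, |dev σ i φ s a - dev σE i φ s a| * u := by
          refine (Finset.abs_sum_le_sum_abs _ _).trans (Finset.sum_le_sum fun a _ => ?_)
          rw [abs_mul]
          exact mul_le_mul_of_nonneg_left (hu _ (Nat.sub_le _ _) s a) (abs_nonneg _)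
      _ ≤ (∑ a, |σ s a - σE s a|) * u := by
          rw [← Finset.sum_mul]
          exact mul_le_mul_of_nonneg_right (sum_abs_dev_sub_dev_le σ σE i φ s) hu0
      _ = 2 * u * tv (σE s) (σ s) := by
          simp only [tv, abs_sub_comm (σE s _)]
          ring
  have hvisit : ∑ h ∈ Finset.range G.H, ∑ s, stateDist G (dev σ i φ) h s * tv (σE s) (σ s)
      = G.H * ∑ s, dAvg G (dev σ i φ) s * tv (σE s) (σ s) := by
    rcases Nat.eq_zero_or_pos G.H with h0 | hpos
    · simp [h0]
    · have hne : (G.H : ℝ) ≠ 0 := by positivity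
      rw [Finset.sum_comm, Finset.mul_sum]
      refine Finset.sum_congr rfl fun s _ => ?_
      rw [dAvg_eq G _ (fun s => (hσ.dev i φ s).2), ← Finset.sum_mul]
      field_simp
  simp only [J]
  rw [Jf_sub_Jf G _ _ _ (fun s => (hσ.dev i φ s).2) (fun s => (hσE.dev i φ s).2)]
  calc _ ≤ ∑ h ∈ Finset.range G.H, ∑ s,
        2 * u * (stateDist G (dev σ i φ) h s * tv (σE s) (σ s)) := by
        refine (Finset.abs_sum_le_sum_abs _ _).trans (Finset.sum_le_sum fun h _ => ?_)
        refine (Finset.abs_sum_le_sum_abs _ _).trans (Finset.sum_le_sum fun s _ => ?_)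
        rw [abs_mul, abs_of_nonneg (hD h s)]
        exact (mul_le_mul_of_nonneg_left (hlocal h s) (hD h s)).trans_eq (by ring)
    _ = 2 * u * (G.H * ∑ s, dAvg G (dev σ i φ) s * tv (σE s) (σ s)) := by
        simp only [← Finset.mul_sum, hvisit]
    _ ≤ 2 * u * (G.H * ε) := by gcongr
    _ = 2 * ε * u * G.H := by ring

/-- A uniform comparison of the deviation gains bounds the regret gap. -/
theorem regret_sub_regret_le (G : MG m S A) (hm : 0 < m) (Φ : ∀ i : Fin m, Set (S → A i → A i))
    (hΦ : ∀ i, (Φ i).Nonempty) (σ σ' : S → (∀ i, A i) → ℝ) (c : ℝ)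
    (hc : ∀ i, ∀ φ ∈ Φ i,
      J G i (dev σ i φ) - J G i σ ≤ J G i (dev σ' i φ) - J G i σ' + c) :
    regret G σ Φ - regret G σ' Φ ≤ c := by
  have : Nonempty (Fin m) := ⟨⟨0, hm⟩⟩
  have (i : Fin m) : Nonempty (Φ i) := (hΦ i).to_subtype
  rw [sub_le_iff_le_add']
  refine ciSup_le fun i => ciSup_le fun φ => (hc i φ.1 φ.2).trans ?_
  gcongr
  refine le_trans ?_ (le_ciSup (Set.finite_range fun i : Fin m =>
    ⨆ φ : Φ i, (J G i (dev σ' i φ.1) - J G i σ')).bddAbove i)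
  exact le_ciSup (Set.finite_range fun φ : Φ i =>
    J G i (dev σ' i φ.1) - J G i σ').bddAbove φ

/-- **BLADES regret gap upper bound.** There is a universal constant
`C` such that in any `u`-recoverable finite Markov Game, a BLADES loss guarantee of
`ε` implies a regret gap of at most `C·ε·u·H`. -/
theorem blades_regret_gap_upper_bound :
    ∃ C : ℝ, 0 < C ∧
      ∀ (m : ℕ) (S : Type) (A : Fin m → Type) [Fintype S] [∀ i, Fintype (A i)]
        (G : MG m S A), IsMG G → 0 < m →
        ∀ (Φ : ∀ i : Fin m, Set (S → A i → A i)),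
        (∀ i : Fin m, (fun (_ : S) (a : A i) => a) ∈ Φ i) →
        ∀ (σE σ : S → (∀ i, A i) → ℝ), IsPolicy σE → IsPolicy σ →
        ∀ (u ε : ℝ), Recoverable G Φ σE u →
        (∀ i : Fin m, ∀ φ ∈ Φ i,
          (∑ s, dAvg G (dev σ i φ) s * tv (σE s) (σ s)) ≤ ε) →
        regret G σ Φ - regret G σE Φ ≤ C * ε * u * G.H := by
  refine ⟨4, by norm_num, ?_⟩
  intro m S A _ _ G hG hm Φ hΦ σE σ hσE hσ u ε hu hε
  have hu0 : 0 ≤ u := by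
    obtain ⟨s, -, -⟩ := Finset.exists_ne_zero_of_sum_ne_zero (hG.2.1 ▸ one_ne_zero)
    obtain ⟨a, -, -⟩ := Finset.exists_ne_zero_of_sum_ne_zero ((hσ s).2 ▸ one_ne_zero)
    exact (abs_nonneg _).trans (hu ⟨0, hm⟩ _ (hΦ _) 0 (Nat.zero_le _) s a)
  refine regret_sub_regret_le G hm Φ (fun i => ⟨_, hΦ i⟩) σ σE _ fun i φ hφ => ?_
  have hdev := abs_J_dev_sub_J_dev_le G hG hσE hσ i φ hu0 (hu i φ hφ) (hε i φ hφ)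
  have hobey := abs_J_dev_sub_J_dev_le G hG hσE hσ i _ hu0 (hu i _ (hΦ i)) (hε i _ (hΦ i))
  rw [dev_id, dev_id] at hobey
  linarith [abs_le.1 hdev, abs_le.1 hobey]

end MAIL
end
end
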